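/- Let u and v be independent random vectors, each uniformly distributed on the unit sphere S² in ℝ³. Then the random variable ϑ := |u × v| (the norm of the cross product, equal to sin of the angle between u and v) has probability density t ↦ t/√(1−t²) on [0,1], and the normalized cross product w := (u × v)/|u × v| is uniformly distributed on S² and is independent of ϑ. -/

import Mathlib

open MeasureTheory ProbabilityTheory InnerProductGeometry Real Set
open scoped ENNReal NNReal

noncomputable section

abbrev E3 : Type := EuclideanSpace ℝ (Fin 3)
abbrev S2 : Type := Metric.sphere (0 : E3) 1

/-- Uniform (normalized) probability measure on the unit sphere `S²`. -/
noncomputable def uniformS2 : Measure S2 :=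
  ((volume : Measure E3).toSphere Set.univ)⁻¹ • (volume : Measure E3).toSphere

/-- Uniform measure on `S²`, viewed as a measure on `ℝ³` (supported on the sphere). -/
noncomputable def uniformS2amb : Measure E3 := uniformS2.map Subtype.val

/-- Cross product on `ℝ³`. -/
noncomputable def cross3 (u v : E3) : E3 :=
  (WithLp.equiv 2 (Fin 3 → ℝ)).symm
    (crossProduct ((WithLp.equiv 2 (Fin 3 → ℝ)) u) ((WithLp.equiv 2 (Fin 3 → ℝ)) v))

lemma aux_polar (g : ℝ → ℝ≥0∞) (hg : Measurable g) :
    ∫⁻ p : ℝ × ℝ, g (p.1 ^ 2 + p.2 ^ 2) = ENNReal.ofReal π * ∫⁻ r in Ioi (0:ℝ), g r := by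
  rw [← lintegral_comp_polarCoord_symm]
  have h1 : ∀ p : ℝ × ℝ, ENNReal.ofReal p.1 • g ((polarCoord.symm p).1 ^ 2 + (polarCoord.symm p).2 ^ 2)
      = ENNReal.ofReal p.1 * g (p.1 ^ 2) := by
    intro p
    rw [smul_eq_mul, polarCoord_symm_apply]
    congr 2
    have := Real.sin_sq_add_cos_sq p.2
    simp only
    linear_combination p.1 ^ 2 * this
  simp_rw [h1]
  have ht : polarCoord.target = Ioi (0:ℝ) ×ˢ Ioo (-π) π := rfl
  rw [ht, Measure.volume_eq_prod, ← Measure.prod_restrict]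
  have h2 := lintegral_image_eq_lintegral_abs_deriv_mul (s := Ioi (0:ℝ)) (f := fun x => x ^ 2)
    (f' := fun x => 2 * x) measurableSet_Ioi
    (fun x hx => by simpa using (hasDerivAt_pow 2 x).hasDerivWithinAt)
    (fun x hx y hy h => by
      have hx' : (0:ℝ) < x := hx
      have hy' : (0:ℝ) < y := hy
      exact (pow_left_inj₀ hx'.le hy'.le two_ne_zero).1 h) g
  have himg : (fun x : ℝ => x ^ 2) '' Ioi 0 = Ioi 0 := by
    ext y
    constructor
    · rintro ⟨x, hx, rfl⟩
      have hx' : (0:ℝ) < x := hx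
      exact pow_pos hx' 2
    · intro hy
      have hy' : (0:ℝ) < y := hy
      exact ⟨√y, Real.sqrt_pos.2 hy', Real.sq_sqrt hy'.le⟩
  rw [himg] at h2
  rw [h2]
  rw [lintegral_prod _ (by fun_prop)]
  simp only [lintegral_const, Measure.restrict_apply_univ, Real.volume_Ioo]
  rw [lintegral_mul_const _ (by fun_prop)]
  have h5 : ∀ x ∈ Ioi (0:ℝ), ENNReal.ofReal |2 * x| * g (x ^ 2)
      = 2 * (ENNReal.ofReal x * g (x ^ 2)) := by
    intro x hx
    have hx' : (0:ℝ) < x := hx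
    rw [abs_of_pos (by positivity), ENNReal.ofReal_mul (by norm_num), mul_assoc]
    simp
  rw [setLIntegral_congr_fun measurableSet_Ioi h5, lintegral_const_mul _ (by fun_prop)]
  have h6 : ENNReal.ofReal (π - -π) = ENNReal.ofReal π * 2 := by
    rw [show π - -π = π * 2 by ring, ENNReal.ofReal_mul Real.pi_pos.le]
    simp
  rw [h6]
  ring

lemma aux_coords (G : ℝ → ℝ → ℝ≥0∞) (hG : Measurable (Function.uncurry G)) :
    ∫⁻ x : E3, G (x 0) ((x 1) ^ 2 + (x 2) ^ 2) =
      ∫⁻ z : ℝ, ENNReal.ofReal π * ∫⁻ r in Ioi (0:ℝ), G z r := by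
  have m1 := EuclideanSpace.volume_preserving_symm_measurableEquiv_toLp (Fin 3)
  have m2 := volume_preserving_piFinSuccAbove (fun _ : Fin 3 => ℝ) 0
  have m3 := (MeasurePreserving.id (volume : Measure ℝ)).prod (volume_preserving_finTwoArrow ℝ)
  have m := (m3.comp (m2.comp m1))
  have hF : Measurable (fun p : ℝ × ℝ × ℝ => G p.1 (p.2.1 ^ 2 + p.2.2 ^ 2)) :=
    hG.comp (f := fun p : ℝ × ℝ × ℝ => (p.1, p.2.1 ^ 2 + p.2.2 ^ 2)) (by fun_prop)
  have h := m.lintegral_comp hF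
  have e : ∀ x : E3, G (x 0) ((x 1) ^ 2 + (x 2) ^ 2) = 
    (fun p : ℝ × ℝ × ℝ => G p.1 (p.2.1 ^ 2 + p.2.2 ^ 2)) ((Prod.map id (MeasurableEquiv.finTwoArrow (α := ℝ)) ∘
      (MeasurableEquiv.piFinSuccAbove (fun _ : Fin 3 => ℝ) 0) ∘ 
        (MeasurableEquiv.toLp 2 (Fin 3 → ℝ)).symm) x) := by
    intro x
    rfl
  simp_rw [e]
  refine h.trans ?_
  rw [lintegral_prod _ hF.aemeasurable]
  refine lintegral_congr fun z => ?_
  exact aux_polar (G z) (hG.comp (f := fun r => (z, r)) (by fun_prop))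

lemma aux_archi (f : ℝ → ℝ≥0∞) (hf : Measurable f) :
    ∫⁻ x : E3 in {x | 0 < ‖x‖ ∧ ‖x‖ < 1}, f (x 0 / ‖x‖) =
      (ENNReal.ofReal π * ∫⁻ q in Ioo (0:ℝ) 1, ENNReal.ofReal (√q)) *
        ∫⁻ s in Ioo (-1:ℝ) 1, f s := by
  have hm : MeasurableSet {x : E3 | 0 < ‖x‖ ∧ ‖x‖ < 1} :=
    (measurableSet_lt measurable_const measurable_norm).inter
      (measurableSet_lt measurable_norm measurable_const)
  rw [← lintegral_indicator hm]
  let G : ℝ → ℝ → ℝ≥0∞ := fun z r =>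
    if 0 < z ^ 2 + r ∧ z ^ 2 + r < 1 then f (z / √(z ^ 2 + r)) else 0
  have hG : Measurable (Function.uncurry G) := by
    refine Measurable.ite ?_ (by fun_prop) measurable_const
    have hc : Measurable (fun p : ℝ × ℝ => p.1 ^ 2 + p.2) := by fun_prop
    exact (measurableSet_lt measurable_const hc).inter (measurableSet_lt hc measurable_const)
  have e : ∀ x : E3, ({x : E3 | 0 < ‖x‖ ∧ ‖x‖ < 1}).indicator (fun x => f (x 0 / ‖x‖)) x =
      G (x 0) ((x 1) ^ 2 + (x 2) ^ 2) := by
    intro x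
    have hn : ‖x‖ = √((x 0) ^ 2 + ((x 1) ^ 2 + (x 2) ^ 2)) := by
      rw [EuclideanSpace.norm_eq, Fin.sum_univ_three]
      simp [add_assoc]
    have h1 : (0 < ‖x‖ ∧ ‖x‖ < 1) ↔ (0 < (x 0) ^ 2 + ((x 1) ^ 2 + (x 2) ^ 2) ∧
        (x 0) ^ 2 + ((x 1) ^ 2 + (x 2) ^ 2) < 1) := by
      rw [hn, Real.sqrt_pos, Real.sqrt_lt' one_pos, one_pow]
    simp only [G, indicator, mem_ofPred_eq]
    rw [← hn]
    simp only [h1]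
  simp_rw [e]
  rw [aux_coords G hG, lintegral_const_mul', mul_assoc]
  swap
  · exact ENNReal.ofReal_ne_top
  congr 1
  let K : ℝ → ℝ → ℝ≥0∞ := fun z q => if z ^ 2 < q ∧ q < 1 then f (z / √q) else 0
  have hK : Measurable (Function.uncurry K) := by
    refine Measurable.ite ?_ (by fun_prop) measurable_const
    have hc : Measurable (fun p : ℝ × ℝ => p.1 ^ 2) := by fun_prop
    exact (measurableSet_lt hc measurable_snd).inter
      (measurableSet_lt measurable_snd measurable_const)
  have e2 : ∀ z, ∫⁻ r in Ioi (0:ℝ), G z r = ∫⁻ q, K z q := by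
    intro z
    rw [← lintegral_indicator measurableSet_Ioi, ← lintegral_sub_right_eq_self _ (z ^ 2)]
    refine lintegral_congr fun q => ?_
    simp only [G, K, indicator, mem_Ioi, add_sub_cancel]
    by_cases h : z ^ 2 < q
    · have : 0 < q := lt_of_le_of_lt (sq_nonneg z) h
      simp [h, this]
    · simp [h]
  simp_rw [e2]
  rw [lintegral_lintegral_swap hK.aemeasurable, ← lintegral_mul_const _ (by fun_prop),
    ← lintegral_indicator measurableSet_Ioo]
  refine lintegral_congr fun q => ?_
  by_cases hq : q ∈ Ioo (0:ℝ) 1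
  · rw [indicator_of_mem hq]
    have hs : 0 < √q := Real.sqrt_pos.2 hq.1
    have h2 := lintegral_image_eq_lintegral_abs_deriv_mul (s := univ) (f := fun x => √q * x)
      (f' := fun x => √q) MeasurableSet.univ
      (fun x hx => by
        have h0 := (hasDerivAt_id' x).const_mul (√q)
        rw [mul_one] at h0
        exact h0.hasDerivWithinAt)
      (fun x hx y hy h => mul_left_cancel₀ hs.ne' h) (fun z => K z q)
    rw [image_univ_of_surjective (mul_left_surjective₀ hs.ne'), Measure.restrict_univ,
      abs_of_pos hs, lintegral_const_mul' _ _ ENNReal.ofReal_ne_top] at h2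
    rw [h2, ← lintegral_indicator measurableSet_Ioo]
    congr 1
    refine lintegral_congr fun s => ?_
    simp only [K, indicator, mem_Ioo]
    rw [mul_div_cancel_left₀ _ hs.ne', mul_pow, Real.sq_sqrt hq.1.le]
    have : (q * s ^ 2 < q ∧ q < 1) ↔ (-1 < s ∧ s < 1) := by
      rw [← abs_lt, ← sq_lt_one_iff_abs_lt_one]
      constructor
      · intro h
        by_contra h'
        nlinarith [hq.1, h.1]
      · intro h
        exact ⟨by nlinarith [hq.1], hq.2⟩
    simp only [this]
  · rw [indicator_of_notMem hq]
    have : ∀ z, K z q = 0 := by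
      intro z
      simp only [K]
      rw [if_neg]
      rintro ⟨h1, h2⟩
      exact hq ⟨lt_of_le_of_lt (sq_nonneg z) h1, h2⟩
    simp [this]

lemma aux_meas_Bp : MeasurableSet {x : E3 | 0 < ‖x‖ ∧ ‖x‖ < 1} :=
  (measurableSet_lt measurable_const measurable_norm).inter
    (measurableSet_lt measurable_norm measurable_const)

lemma aux_meas_nrm : Measurable (fun x : E3 => ‖x‖⁻¹ • x) :=
  (measurable_norm.inv).smul measurable_id

lemma aux_rep : ∃ c : ℝ≥0∞, uniformS2amb =
    c • ((volume : Measure E3).restrict {x | 0 < ‖x‖ ∧ ‖x‖ < 1}).map (fun x => ‖x‖⁻¹ • x) := by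
  refine ⟨((volume : Measure E3).toSphere Set.univ)⁻¹ * (Module.finrank ℝ E3 : ℝ≥0∞), ?_⟩
  ext A hA
  have hA' : MeasurableSet ((Subtype.val : S2 → E3) ⁻¹' A) := measurable_subtype_coe hA
  rw [uniformS2amb, Measure.map_apply measurable_subtype_coe hA, uniformS2, Measure.smul_apply,
    Measure.toSphere_apply' _ hA', Measure.smul_apply, Measure.map_apply aux_meas_nrm hA,
    Measure.restrict_apply (aux_meas_nrm hA), smul_eq_mul, smul_eq_mul, mul_assoc]
  congr 3
  ext x
  simp only [Set.mem_smul, mem_image, mem_preimage, mem_inter_iff, mem_ofPred_eq]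
  constructor
  · rintro ⟨r, hr, y, ⟨z, hz, rfl⟩, rfl⟩
    have hz1 : ‖(z : E3)‖ = 1 := by simp
    have hr0 : r ≠ 0 := hr.1.ne'
    rw [norm_smul, hz1, mul_one, Real.norm_of_nonneg hr.1.le, smul_smul, inv_mul_cancel₀ hr0,
      one_smul]
    exact ⟨hz, hr⟩
  · rintro ⟨h1, h2, h3⟩
    refine ⟨‖x‖, ⟨h2, h3⟩, ‖x‖⁻¹ • x, ⟨⟨‖x‖⁻¹ • x, ?_⟩, h1, rfl⟩, ?_⟩
    · rw [mem_sphere_zero_iff_norm, norm_smul, norm_inv, norm_norm, inv_mul_cancel₀ h2.ne']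
    · rw [smul_smul, mul_inv_cancel₀ h2.ne', one_smul]

instance aux_prob : IsProbabilityMeasure uniformS2amb := by
  have : IsProbabilityMeasure uniformS2 := by
    constructor
    rw [uniformS2, Measure.smul_apply, smul_eq_mul]
    refine ENNReal.inv_mul_cancel ?_ (measure_ne_top _ _)
    rw [Ne, Measure.measure_univ_eq_zero]
    exact Measure.toSphere_ne_zero _
  exact Measure.isProbabilityMeasure_map measurable_subtype_coe.aemeasurable

lemma aux_norm_one : ∀ᵐ x ∂uniformS2amb, ‖x‖ = 1 := by
  rw [uniformS2amb, ae_map_iff measurable_subtype_coe.aemeasurable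
    (measurableSet_eq_fun measurable_norm measurable_const)]
  exact Filter.Eventually.of_forall fun z => by simp

lemma aux_inv (L : E3 ≃ₗᵢ[ℝ] E3) : MeasurePreserving L uniformS2amb uniformS2amb := by
  have hL : Measurable L := L.continuous.measurable
  refine ⟨hL, ?_⟩
  obtain ⟨c, hc⟩ := aux_rep
  rw [hc, Measure.map_smul, Measure.map_map hL aux_meas_nrm]
  have e : (L ∘ fun x : E3 => ‖x‖⁻¹ • x) = (fun x : E3 => ‖x‖⁻¹ • x) ∘ L := by
    ext1 x
    simp
  rw [e, ← Measure.map_map aux_meas_nrm hL]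
  have h := L.measurePreserving.restrict_preimage aux_meas_Bp
  have e2 : L ⁻¹' {x : E3 | 0 < ‖x‖ ∧ ‖x‖ < 1} = {x : E3 | 0 < ‖x‖ ∧ ‖x‖ < 1} := by
    ext x
    simp
  rw [e2] at h
  rw [h.map_eq]

/-- Archimedes: the first coordinate is uniform on `(-1,1)`. -/
lemma aux_coord_law (f : ℝ → ℝ≥0∞) (hf : Measurable f) :
    ∫⁻ x, f (x 0) ∂uniformS2amb = 2⁻¹ * ∫⁻ s in Ioo (-1:ℝ) 1, f s := by
  obtain ⟨c, hc⟩ := aux_rep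
  have key : ∀ f : ℝ → ℝ≥0∞, Measurable f → ∫⁻ x, f (x 0) ∂uniformS2amb =
      (c * (ENNReal.ofReal π * ∫⁻ q in Ioo (0:ℝ) 1, ENNReal.ofReal (√q))) *
        ∫⁻ s in Ioo (-1:ℝ) 1, f s := by
    intro f hf
    have hf0 : Measurable (fun x : E3 => f (x 0)) := by fun_prop
    rw [hc, lintegral_smul_measure, lintegral_map hf0 aux_meas_nrm, smul_eq_mul, mul_assoc,
      ← aux_archi f hf]
    congr 1
    refine lintegral_congr fun x => ?_
    simp [div_eq_inv_mul]
  have h1 := key (fun _ => 1) measurable_const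
  simp only [lintegral_const, measure_univ, mul_one, Measure.restrict_apply_univ,
    Real.volume_Ioo] at h1
  rw [key f hf]
  congr 1
  rw [eq_comm, show (1 - -1 : ℝ) = 2 by norm_num] at h1
  have := ENNReal.eq_inv_of_mul_eq_one_left h1
  simpa using this

lemma aux_inner_law (f : ℝ → ℝ≥0∞) (hf : Measurable f) (e : E3) (he : ‖e‖ = 1) :
    ∫⁻ x, f (inner ℝ e x) ∂uniformS2amb = 2⁻¹ * ∫⁻ s in Ioo (-1:ℝ) 1, f s := by
  let e0 : E3 := EuclideanSpace.single 0 1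
  have he0 : ‖e‖ = ‖e0‖ := by simp [e0, he]
  have h := Submodule.reflection_sub he0
  rw [← aux_coord_law f hf]
  have hf0 : Measurable (fun x : E3 => f (x 0)) := by fun_prop
  rw [← (aux_inv (Submodule.reflection (Submodule.span ℝ {e - e0})ᗮ)).lintegral_comp hf0]
  refine lintegral_congr fun x => ?_
  congr 1
  rw [← LinearIsometryEquiv.inner_map_map (Submodule.reflection (Submodule.span ℝ {e - e0})ᗮ), h]
  simp [e0, EuclideanSpace.inner_single_left]

lemma aux_unique (ν : Measure E3) [IsFiniteMeasure ν] (h1 : ∀ᵐ x ∂ν, ‖x‖ = 1)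
    (h2 : ∀ a : E3, a ≠ 0 → 
      ν.map (Submodule.reflection (Submodule.span ℝ {a})ᗮ) = ν) :
    ν = ν univ • uniformS2amb := by
  have rad : ∀ (ρ : Measure E3), (∀ a : E3, a ≠ 0 → 
      ρ.map (Submodule.reflection (Submodule.span ℝ {a})ᗮ) = ρ) → ∀ x y : E3, ‖x‖ = ‖y‖ →
      charFun ρ x = charFun ρ y := by
    intro ρ hρ x y hxy
    by_cases hne : x - y = 0
    · rw [sub_eq_zero.1 hne]
    have hL := Submodule.reflection_sub hxy
    have hρ' := hρ _ hne
    generalize (Submodule.span ℝ {x - y})ᗮ.reflection = L at hL hρ'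
    rw [charFun_apply, charFun_apply, ← hL]
    conv_rhs => rw [← hρ']
    rw [integral_map L.continuous.measurable.aemeasurable
      (Continuous.aestronglyMeasurable (by fun_prop))]
    simp
  have : IsFiniteMeasure (ν univ • uniformS2amb) := by
    constructor
    simp
  apply Measure.ext_of_charFun
  ext ξ
  have hc : charFun (ν univ • uniformS2amb) ξ = (ν univ).toReal * charFun uniformS2amb ξ := by
    rw [charFun_apply, integral_smul_measure, charFun_apply]
    simp
  rw [hc]
  have hsw := integral_integral_swap (μ := uniformS2amb) (ν := ν)
    (f := fun y x => Complex.exp (((inner ℝ x (‖ξ‖ • y) : ℝ) : ℂ) * Complex.I)) (by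
      refine Integrable.of_bound (C := 1) (Continuous.aestronglyMeasurable (by
        unfold Function.uncurry; fun_prop)) (Filter.Eventually.of_forall fun p => ?_)
      simp only [Function.uncurry]
      rw [Complex.norm_exp_ofReal_mul_I])
  have hl : ∫ y, ∫ x, Complex.exp (((inner ℝ x (‖ξ‖ • y) : ℝ) : ℂ) * Complex.I) ∂ν ∂uniformS2amb
      = charFun ν ξ := by
    rw [integral_congr_ae (g := fun _ => charFun ν ξ)]
    · simp
    · filter_upwards [aux_norm_one] with y hy
      rw [← charFun_apply]
      exact rad ν h2 _ _ (by simp [norm_smul, hy])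
  have hr : ∫ x, ∫ y, Complex.exp (((inner ℝ x (‖ξ‖ • y) : ℝ) : ℂ) * Complex.I) ∂uniformS2amb ∂ν
      = (ν univ).toReal * charFun uniformS2amb ξ := by
    rw [integral_congr_ae (g := fun _ => charFun uniformS2amb ξ)]
    · simp [Measure.real]
    · filter_upwards [h1] with x hx
      have : ∀ y : E3, (inner ℝ x (‖ξ‖ • y) : ℝ) = inner ℝ y (‖ξ‖ • x) := by
        intro y
        rw [inner_smul_right, inner_smul_right, real_inner_comm]
      simp_rw [this]
      rw [← charFun_apply]
      exact rad uniformS2amb (fun a _ => (aux_inv _).map_eq) _ _ (by simp [norm_smul, hx])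
  rw [← hl, hsw, hr]

lemma aux_cross0 (u v : E3) : cross3 u v 0 = u 1 * v 2 - u 2 * v 1 := by
  simp [cross3, cross_apply]

lemma aux_cross1 (u v : E3) : cross3 u v 1 = u 2 * v 0 - u 0 * v 2 := by
  simp [cross3, cross_apply]

lemma aux_cross2 (u v : E3) : cross3 u v 2 = u 0 * v 1 - u 1 * v 0 := by
  simp [cross3, cross_apply]

lemma aux_refl (a : E3) (x : E3) (i : Fin 3) :
    ((Submodule.span ℝ {a})ᗮ.reflection x) i
      = x i - (2 / (a 0 ^ 2 + a 1 ^ 2 + a 2 ^ 2)) * (a 0 * x 0 + a 1 * x 1 + a 2 * x 2) * a i := by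
  rw [Submodule.reflection_orthogonal_apply, Submodule.reflection_singleton_apply]
  have h1 : ((‖a‖ : ℝ)) ^ 2 = a 0 ^ 2 + a 1 ^ 2 + a 2 ^ 2 := by
    rw [EuclideanSpace.norm_sq_eq, Fin.sum_univ_three]
    simp
  have h2 : inner ℝ a x = a 0 * x 0 + a 1 * x 1 + a 2 * x 2 := by
    rw [PiLp.inner_apply, Fin.sum_univ_three]
    simp [mul_comm]
  simp [h1, h2]
  ring

lemma aux_cross_refl (a u v : E3) (ha : a ≠ 0) :
    cross3 ((Submodule.span ℝ {a})ᗮ.reflection v) ((Submodule.span ℝ {a})ᗮ.reflection u)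
      = (Submodule.span ℝ {a})ᗮ.reflection (cross3 u v) := by
  have h1 : ((‖a‖ : ℝ)) ^ 2 = a 0 ^ 2 + a 1 ^ 2 + a 2 ^ 2 := by
    rw [EuclideanSpace.norm_sq_eq, Fin.sum_univ_three]
    simp
  have h0 : a 0 ^ 2 + a 1 ^ 2 + a 2 ^ 2 ≠ 0 := by
    rw [← h1]
    simpa using ha
  have hk : (2 / (a 0 ^ 2 + a 1 ^ 2 + a 2 ^ 2)) * (a 0 ^ 2 + a 1 ^ 2 + a 2 ^ 2) = 2 :=
    div_mul_cancel₀ _ h0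
  ext i
  fin_cases i
  · simp only [Fin.zero_eta, Fin.mk_one, Fin.reduceFinMk, aux_cross0, aux_cross1, aux_cross2, aux_refl]
    linear_combination (u 1 * v 2 - u 2 * v 1) * hk
  · simp only [Fin.zero_eta, Fin.mk_one, Fin.reduceFinMk, aux_cross0, aux_cross1, aux_cross2, aux_refl]
    linear_combination (u 2 * v 0 - u 0 * v 2) * hk
  · simp only [Fin.zero_eta, Fin.mk_one, Fin.reduceFinMk, aux_cross0, aux_cross1, aux_cross2, aux_refl]
    linear_combination (u 0 * v 1 - u 1 * v 0) * hk

lemma aux_cross_norm (u v : E3) (hu : ‖u‖ = 1) (hv : ‖v‖ = 1) :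
    ‖cross3 u v‖ = √(1 - (inner ℝ u v) ^ 2) := by
  have n1 : ∀ a : E3, (‖a‖ : ℝ) ^ 2 = a 0 ^ 2 + a 1 ^ 2 + a 2 ^ 2 := by
    intro a
    rw [EuclideanSpace.norm_sq_eq, Fin.sum_univ_three]
    simp
  have h2 : inner ℝ u v = u 0 * v 0 + u 1 * v 1 + u 2 * v 2 := by
    rw [PiLp.inner_apply, Fin.sum_univ_three]
    simp [mul_comm]
  rw [← Real.sqrt_sq (norm_nonneg (cross3 u v)), n1, h2, aux_cross0, aux_cross1, aux_cross2]
  have a1 := n1 u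
  have a2 := n1 v
  rw [hu, one_pow] at a1
  rw [hv, one_pow] at a2
  congr 1
  linear_combination (-1) * a1 - (u 0 ^ 2 + u 1 ^ 2 + u 2 ^ 2) * a2

lemma aux_cross_cont : Continuous (fun p : E3 × E3 => cross3 p.1 p.2) := by
  rw [← (PiLp.homeomorph 2 (fun _ : Fin 3 => ℝ)).comp_continuous_iff]
  refine continuous_pi fun i => ?_
  fin_cases i
  · change Continuous (fun p : E3 × E3 => cross3 p.1 p.2 0)
    simp only [aux_cross0]
    fun_prop
  · change Continuous (fun p : E3 × E3 => cross3 p.1 p.2 1)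
    simp only [aux_cross1]
    fun_prop
  · change Continuous (fun p : E3 × E3 => cross3 p.1 p.2 2)
    simp only [aux_cross2]
    fun_prop

lemma aux_subst (f : ℝ → ℝ≥0∞) (hf : Measurable f) :
    2⁻¹ * ∫⁻ s in Ioo (-1:ℝ) 1, f (√(1 - s ^ 2)) =
      ∫⁻ t in Ioo (0:ℝ) 1, ENNReal.ofReal (t / √(1 - t ^ 2)) * f t := by
  have hsplit : ∫⁻ s in Ioo (-1:ℝ) 1, f (√(1 - s ^ 2)) =
      2 * ∫⁻ s in Ioo (0:ℝ) 1, f (√(1 - s ^ 2)) := by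
    have hneg := lintegral_image_eq_lintegral_abs_deriv_mul (s := Ioo (0:ℝ) 1) (f := fun x => -x)
      (f' := fun x => -1) measurableSet_Ioo
      (fun x hx => (hasDerivAt_neg' x).hasDerivWithinAt)
      (fun x hx y hy h => neg_injective h) (fun s => f (√(1 - s ^ 2)))
    simp only [image_neg_eq_neg, Set.neg_Ioo, neg_zero, abs_neg, abs_one, ENNReal.ofReal_one, one_mul, neg_sq] at hneg
    rw [← Ioc_union_Ioo_eq_Ioo (show (-1:ℝ) ≤ 0 by norm_num) (show (0:ℝ) < 1 by norm_num),
      lintegral_union measurableSet_Ioo, setLIntegral_congr Ioo_ae_eq_Ioc.symm, hneg, two_mul]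
    exact Set.disjoint_left.2 fun x hx hy => absurd hx.2 (not_le.2 hy.1)
  rw [hsplit, ← mul_assoc, ENNReal.inv_mul_cancel (by norm_num) (by norm_num), one_mul]
  have hpos : ∀ x ∈ Ioo (0:ℝ) 1, 0 < 1 - x ^ 2 := fun x hx => by nlinarith [hx.1, hx.2]
  have hinv : ∀ x ∈ Ioo (0:ℝ) 1, √(1 - (√(1 - x ^ 2)) ^ 2) = x := by
    intro x hx
    rw [Real.sq_sqrt (hpos x hx).le, sub_sub_cancel, Real.sqrt_sq hx.1.le]
  have hmap : ∀ x ∈ Ioo (0:ℝ) 1, √(1 - x ^ 2) ∈ Ioo (0:ℝ) 1 := by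
    intro x hx
    refine ⟨Real.sqrt_pos.2 (hpos x hx), ?_⟩
    rw [Real.sqrt_lt' one_pos]
    nlinarith [hx.1]
  have h := lintegral_image_eq_lintegral_abs_deriv_mul (s := Ioo (0:ℝ) 1)
    (f := fun x => √(1 - x ^ 2)) (f' := fun x => -(x / √(1 - x ^ 2))) measurableSet_Ioo
      (fun x hx => by
        have h1 : HasDerivAt (fun x : ℝ => 1 - x ^ 2) (-(2 * x)) x := by
          simpa using (hasDerivAt_pow 2 x).const_sub 1
        have h2 := h1.sqrt (hpos x hx).ne'
        rw [neg_div, mul_div_mul_left _ _ two_ne_zero] at h2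
        exact h2.hasDerivWithinAt)
      (fun x hx y hy h => by
        have h' : √(1 - x ^ 2) = √(1 - y ^ 2) := h
        rw [← hinv x hx, h', hinv y hy]) (fun s => f (√(1 - s ^ 2)))
  have himg : (fun x => √(1 - x ^ 2)) '' Ioo (0:ℝ) 1 = Ioo 0 1 := by
    ext y
    constructor
    · rintro ⟨x, hx, rfl⟩
      exact hmap x hx
    · intro hy
      exact ⟨_, hmap y hy, hinv y hy⟩
  rw [himg] at h
  rw [h]
  refine setLIntegral_congr_fun measurableSet_Ioo fun x hx => ?_
  rw [hinv x hx, abs_neg, abs_of_nonneg (div_nonneg hx.1.le (Real.sqrt_nonneg _))]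

lemma aux_theta : (uniformS2amb.prod uniformS2amb).map (fun p => ‖cross3 p.1 p.2‖) =
    volume.withDensity
        (fun t : ℝ => ENNReal.ofReal
          (if t ∈ Set.Icc (0:ℝ) 1 then t / Real.sqrt (1 - t ^ 2) else 0)) := by
  have hT : Measurable (fun p : E3 × E3 => ‖cross3 p.1 p.2‖) := aux_cross_cont.norm.measurable
  ext B hB
  have hB1 : Measurable (B.indicator (fun _ => (1:ℝ≥0∞))) := measurable_const.indicator hB
  rw [← lintegral_indicator_one hB]
  change ∫⁻ a, B.indicator (fun _ => (1:ℝ≥0∞)) a ∂_ = _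
  rw [lintegral_map hB1 hT,
    lintegral_prod (fun p : E3 × E3 => B.indicator (fun _ => (1:ℝ≥0∞)) ‖cross3 p.1 p.2‖)
      (hB1.comp hT).aemeasurable]
  have e : ∀ᵐ u ∂uniformS2amb, ∫⁻ v, B.indicator (fun _ => (1:ℝ≥0∞)) ‖cross3 u v‖ ∂uniformS2amb
      = 2⁻¹ * ∫⁻ s in Ioo (-1:ℝ) 1, B.indicator (fun _ => (1:ℝ≥0∞)) (√(1 - s ^ 2)) := by
    filter_upwards [aux_norm_one] with u hu
    rw [← aux_inner_law (fun s => B.indicator (fun _ => (1:ℝ≥0∞)) (√(1 - s ^ 2)))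
      (by fun_prop) u hu]
    refine lintegral_congr_ae ?_
    filter_upwards [aux_norm_one] with v hv
    rw [aux_cross_norm u v hu hv]
  rw [lintegral_congr_ae e, lintegral_const, measure_univ, mul_one, aux_subst _ hB1,
    withDensity_apply _ hB, ← lintegral_indicator hB, setLIntegral_congr Ioo_ae_eq_Icc,
    ← lintegral_indicator measurableSet_Icc]
  refine lintegral_congr fun t => ?_
  by_cases h1 : t ∈ B <;> by_cases h2 : t ∈ Icc (0:ℝ) 1 <;> simp [h1, h2, -mem_Icc]

lemma aux_joint (B : Set ℝ) (hB : MeasurableSet B) (A : Set E3) (hA : MeasurableSet A) :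
    (uniformS2amb.prod uniformS2amb) ((fun p => ‖cross3 p.1 p.2‖⁻¹ • cross3 p.1 p.2) ⁻¹' A ∩
        (fun p => ‖cross3 p.1 p.2‖) ⁻¹' B) =
      uniformS2amb A * (uniformS2amb.prod uniformS2amb) ((fun p => ‖cross3 p.1 p.2‖) ⁻¹' B) := by
  have hT : Measurable (fun p : E3 × E3 => ‖cross3 p.1 p.2‖) := aux_cross_cont.norm.measurable
  have hW : Measurable (fun p : E3 × E3 => ‖cross3 p.1 p.2‖⁻¹ • cross3 p.1 p.2) :=
    aux_meas_nrm.comp aux_cross_cont.measurable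
  have hTB := hT hB
  set T : E3 × E3 → ℝ := fun p => ‖cross3 p.1 p.2‖ with hTdef
  set W : E3 × E3 → E3 := fun p => ‖cross3 p.1 p.2‖⁻¹ • cross3 p.1 p.2 with hWdef
  set P := uniformS2amb.prod uniformS2amb with hP
  have h0 : ∀ᵐ p ∂P, T p ≠ 0 := by
    have : P.map T {0} = 0 := by
      rw [aux_theta]
      exact (withDensity_absolutelyContinuous _ _) (by simp)
    rw [Measure.map_apply hT (measurableSet_singleton 0)] at this
    rw [ae_iff]
    simpa [preimage] using this
  have hu := aux_unique ((P.restrict (T ⁻¹' B)).map W) (by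
      rw [ae_map_iff hW.aemeasurable (measurableSet_eq_fun measurable_norm measurable_const)]
      filter_upwards [ae_restrict_of_ae h0] with p hp
      have hp' : ‖cross3 p.1 p.2‖ ≠ 0 := hp
      simp only [hWdef]
      rw [norm_smul, norm_inv, norm_norm, inv_mul_cancel₀ hp']) (by
      intro a ha
      have hc := aux_cross_refl a
      have hL : Measurable (Submodule.reflection (Submodule.span ℝ {a})ᗮ) :=
        (Submodule.reflection (Submodule.span ℝ {a})ᗮ).continuous.measurable
      have hinv := aux_inv (Submodule.reflection (Submodule.span ℝ {a})ᗮ)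
      generalize Submodule.reflection (Submodule.span ℝ {a})ᗮ = L at hc hL hinv
      have hΦ : MeasurePreserving (Prod.map L L ∘ Prod.swap) P P :=
        (hinv.prod hinv).comp Measure.measurePreserving_swap
      have hcΦ : ∀ p, cross3 ((Prod.map L L ∘ Prod.swap) p).1 ((Prod.map L L ∘ Prod.swap) p).2
          = L (cross3 p.1 p.2) := fun p => hc p.1 p.2 ha
      have hTΦ : (Prod.map L L ∘ Prod.swap) ⁻¹' (T ⁻¹' B) = T ⁻¹' B := by
        ext p
        simp only [mem_preimage, hTdef, hcΦ, LinearIsometryEquiv.norm_map]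
      have hWΦ : L ∘ W = W ∘ (Prod.map L L ∘ Prod.swap) := by
        funext p
        simp only [hWdef, Function.comp_apply (g := (Prod.map L L ∘ Prod.swap)),
          Function.comp_apply (f := L), hcΦ, LinearIsometryEquiv.norm_map, map_smul]
      have hr := hΦ.restrict_preimage hTB
      rw [hTΦ] at hr
      rw [Measure.map_map hL hW, hWΦ, ← Measure.map_map hW hΦ.measurable, hr.map_eq])
  have h := congrArg (fun m => m A) hu
  simp only [Measure.smul_apply, smul_eq_mul] at h
  rw [Measure.map_apply hW hA, Measure.restrict_apply (hW hA), Measure.map_apply hW MeasurableSet.univ,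
    preimage_univ, Measure.restrict_apply_univ, mul_comm] at h
  exact h

/-- for independent uniform `u, v` on `S²`, the norm of the cross product
`ϑ = |u × v|` has density `t ↦ t/√(1-t²)` on `[0,1]`, and the normalized cross product
`w = (u × v)/|u × v|` is uniform on `S²` and independent of `ϑ`. -/
theorem stmt_0
    {Ω : Type} [MeasureSpace Ω] [IsProbabilityMeasure (ℙ : Measure Ω)]
    (u v : Ω → E3)
    (hu : Measure.map u ℙ = uniformS2amb) (hv : Measure.map v ℙ = uniformS2amb)
    (huv : IndepFun u v ℙ) :
    Measure.map (fun ω => ‖cross3 (u ω) (v ω)‖) ℙ =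
      volume.withDensity
        (fun t : ℝ => ENNReal.ofReal
          (if t ∈ Set.Icc (0:ℝ) 1 then t / Real.sqrt (1 - t ^ 2) else 0)) ∧
    Measure.map (fun ω => ‖cross3 (u ω) (v ω)‖⁻¹ • cross3 (u ω) (v ω)) ℙ = uniformS2amb ∧
    IndepFun (fun ω => ‖cross3 (u ω) (v ω)‖⁻¹ • cross3 (u ω) (v ω))
      (fun ω => ‖cross3 (u ω) (v ω)‖) ℙ := by
  have hum : AEMeasurable u ℙ := by
    by_contra h
    rw [Measure.map_of_not_aemeasurable h] at hu
    exact (IsProbabilityMeasure.ne_zero uniformS2amb) hu.symm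
  have hvm : AEMeasurable v ℙ := by
    by_contra h
    rw [Measure.map_of_not_aemeasurable h] at hv
    exact (IsProbabilityMeasure.ne_zero uniformS2amb) hv.symm
  have hZ : AEMeasurable (fun ω => (u ω, v ω)) ℙ := hum.prodMk hvm
  have hlaw := (indepFun_iff_map_prod_eq_prod_map_map hum hvm).1 huv
  rw [hu, hv] at hlaw
  have hT : Measurable (fun p : E3 × E3 => ‖cross3 p.1 p.2‖) := aux_cross_cont.norm.measurable
  have hW : Measurable (fun p : E3 × E3 => ‖cross3 p.1 p.2‖⁻¹ • cross3 p.1 p.2) :=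
    aux_meas_nrm.comp aux_cross_cont.measurable
  have hW1 : Measure.map (fun p : E3 × E3 => ‖cross3 p.1 p.2‖⁻¹ • cross3 p.1 p.2)
      (uniformS2amb.prod uniformS2amb) = uniformS2amb := by
    ext A hA
    have := aux_joint univ MeasurableSet.univ A hA
    rw [preimage_univ, inter_univ, measure_univ, mul_one] at this
    rw [Measure.map_apply hW hA, this]
  refine ⟨?_, ?_, ?_⟩
  · rw [← aux_theta, ← hlaw, AEMeasurable.map_map_of_aemeasurable hT.aemeasurable hZ]
    rfl
  · conv_rhs => rw [← hW1, ← hlaw, AEMeasurable.map_map_of_aemeasurable hW.aemeasurable hZ]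
    rfl
  · rw [indepFun_iff_measure_inter_preimage_eq_mul]
    intro A B hA hB
    have h := aux_joint B hB A hA
    have hA1 : uniformS2amb A = (uniformS2amb.prod uniformS2amb)
        ((fun p : E3 × E3 => ‖cross3 p.1 p.2‖⁻¹ • cross3 p.1 p.2) ⁻¹' A) := by
      rw [← Measure.map_apply hW hA, hW1]
    rw [hA1, ← hlaw, Measure.map_apply_of_aemeasurable hZ (hW hA),
      Measure.map_apply_of_aemeasurable hZ (hT hB),
      Measure.map_apply_of_aemeasurable hZ ((hW hA).inter (hT hB))] at h
    exact h
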